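/- arXiv:1609.05487 — 3 statements merged into one kernel-verified Lean document; each statement's English description precedes it below -/
import Mathlib

section
/- Let n ≥ 1 be a natural number and let α be a real number with 1/n < α < 1 + 1/n. Set β = (nα − 1)/(nα). Then for every real θ > 0, the quantity J(θ) := 2α(β − θ) + α(θ⁻² + 2θ⁻¹)(β − θ)² + β satisfies J(θ) ≥ β(1 − α + 1/n), and moreover β(1 − α + 1/n) > 0; in particular J(θ) > 0. -/
/-- The Pogorelov coefficient is its lower bound `β (1 - α β)` plus `α` times a square. -/
theorem pogorelov_coefficient_eq (α β : ℝ) {θ : ℝ} (hθ : θ ≠ 0) :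
    2 * α * (β - θ) + α * (θ⁻¹ ^ 2 + 2 * θ⁻¹) * (β - θ) ^ 2 + β
      = β * (1 - α * β) + α * (β * (1 + θ⁻¹) - 1) ^ 2 := by
  field_simp
  ring

/-- Positivity of the coefficient `J_i` in the Pogorelov type computation
(proof of Theorem 3.2): for `1/n < α < 1 + 1/n`, `β = (nα−1)/(nα)` and `θ > 0`,
`J(θ) = 2α(β − θ) + α(θ⁻² + 2θ⁻¹)(β − θ)² + β ≥ β(1 − α + 1/n) > 0`. -/
theorem J_positive (n : ℕ) (hn : 1 ≤ n) (α : ℝ)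
    (hα₁ : 1 / (n : ℝ) < α) (hα₂ : α < 1 + 1 / (n : ℝ))
    (β : ℝ) (hβ : β = ((n : ℝ) * α - 1) / ((n : ℝ) * α)) :
    (∀ θ : ℝ, 0 < θ →
        β * (1 - α + 1 / (n : ℝ))
          ≤ 2 * α * (β - θ) + α * (θ⁻¹ ^ 2 + 2 * θ⁻¹) * (β - θ) ^ 2 + β)
      ∧ 0 < β * (1 - α + 1 / (n : ℝ))
      ∧ ∀ θ : ℝ, 0 < θ →
          0 < 2 * α * (β - θ) + α * (θ⁻¹ ^ 2 + 2 * θ⁻¹) * (β - θ) ^ 2 + β := by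
  have hn₀ : (0 : ℝ) < n := by exact_mod_cast hn
  have hα : 0 < α := (one_div_pos.mpr hn₀).trans hα₁
  have hβ₀ : 0 < β := by
    rw [hβ]
    exact div_pos (sub_pos.mpr ((div_lt_iff₀' hn₀).mp hα₁)) (mul_pos hn₀ hα)
  have hαβ : 1 - α + 1 / (n : ℝ) = 1 - α * β := by
    rw [hβ]
    field_simp
    ring
  have hpos : 0 < β * (1 - α + 1 / (n : ℝ)) := mul_pos hβ₀ (by linarith)
  have hle : ∀ θ : ℝ, 0 < θ → β * (1 - α + 1 / (n : ℝ))
      ≤ 2 * α * (β - θ) + α * (θ⁻¹ ^ 2 + 2 * θ⁻¹) * (β - θ) ^ 2 + β := by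
    intro θ hθ
    rw [pogorelov_coefficient_eq α β hθ.ne', hαβ]
    exact le_add_of_nonneg_right (by positivity)
  exact ⟨hle, hpos, fun θ hθ => hpos.trans_le (hle θ hθ)⟩
end

section
/- Let n ≥ 2 be an integer, let α be a real number with 1/n < α < 1 + 1/n, set β = (nα − 1)/(nα). Let λ₁, …, λₙ be positive real numbers with λ₁ = min_i λᵢ, let c₁, …, cₙ be real numbers, set K = Πᵢ λᵢ, θᵢ = λᵢ/λ₁, I₁ = β + 1 − α, and Jᵢ = 2α(β − θᵢ) + α(θᵢ⁻² + 2θᵢ⁻¹)(β − θᵢ)² + β. If 0 ≥ Σ_{i=2}^{n} cᵢ²·Jᵢ + c₁²·I₁ + (nα − 1)·K^α·(λ₁⁻¹ − (1/n)Σᵢ λᵢ⁻¹), then cᵢ = 0 for all i and λ₁ = λ₂ = ⋯ = λₙ. -/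
/-- Completing the square in `θ⁻¹` shows that the coefficient `J` is positive. -/
lemma pogorelov_coeff_pos {α β θ : ℝ} (hα : 0 < α) (hβ : 0 < β) (hαβ : α * β < 1)
    (hθ : 0 < θ) :
    0 < 2 * α * (β - θ) + α * (θ⁻¹ ^ 2 + 2 * θ⁻¹) * (β - θ) ^ 2 + β := by
  have key : 2 * α * (β - θ) + α * (θ⁻¹ ^ 2 + 2 * θ⁻¹) * (β - θ) ^ 2 + β
      = α * (1 - β * θ⁻¹ - β) ^ 2 + β * (1 - α * β) := by
    field_simp
    ring
  rw [key]
  have h₁ : 0 < β * (1 - α * β) := mul_pos hβ (by linarith)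
  positivity

/-- If the mean of finitely many reals is at least an upper bound, they all equal that bound. -/
lemma eq_of_le_of_le_mean {n : ℕ} (hn : 0 < n) {x : Fin n → ℝ} {a : ℝ} (hx : ∀ i, x i ≤ a)
    (h : a ≤ 1 / (n : ℝ) * ∑ i, x i) (i : Fin n) : x i = a := by
  have hn' : (0 : ℝ) < n := Nat.cast_pos.mpr hn
  have hle : (n : ℝ) * a ≤ ∑ i, x i := by
    rwa [one_div_mul_eq_div, le_div_iff₀ hn', mul_comm] at h
  have hge : ∑ i, x i ≤ ∑ _i : Fin n, a := Finset.sum_le_sum fun i _ => hx i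
  have heq : ∑ i, x i = ∑ _i : Fin n, a := le_antisymm hge (by simpa using hle)
  exact (Finset.sum_eq_sum_iff_of_le fun i _ => hx i).mp heq i (Finset.mem_univ i)

open Finset in
/-- Algebraic core of Theorem 3.2 (Pogorelov type computation), inequality (3.6):
with `β = (nα−1)/(nα)`, positive reals `λᵢ` with `λ_{i₀}` minimal (playing the role
of `λ₁ = λ_min`), `K = Πᵢ λᵢ`, `θᵢ = λᵢ/λ_{i₀}`, `I₁ = β + 1 − α` and
`Jᵢ = 2α(β − θᵢ) + α(θᵢ⁻² + 2θᵢ⁻¹)(β − θᵢ)² + β`, the inequality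
`0 ≥ Σ_{i≠i₀} cᵢ²Jᵢ + c_{i₀}²I₁ + (nα − 1)K^α(λ_{i₀}⁻¹ − (1/n)Σᵢ λᵢ⁻¹)`
forces all `cᵢ = 0` and all the `λᵢ` equal. -/
theorem pogorelov_core (n : ℕ) (hn : 2 ≤ n) (α : ℝ)
    (hα₁ : 1 / (n : ℝ) < α) (hα₂ : α < 1 + 1 / (n : ℝ))
    (β : ℝ) (hβ : β = ((n : ℝ) * α - 1) / ((n : ℝ) * α))
    (lam : Fin n → ℝ) (hpos : ∀ i, 0 < lam i)
    (i₀ : Fin n) (hmin : ∀ i, lam i₀ ≤ lam i)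
    (c : Fin n → ℝ)
    (K : ℝ) (hK : K = ∏ i : Fin n, lam i)
    (θ : Fin n → ℝ) (hθ : ∀ i, θ i = lam i / lam i₀)
    (I₁ : ℝ) (hI₁ : I₁ = β + 1 - α)
    (J : Fin n → ℝ)
    (hJ : ∀ i, J i = 2 * α * (β - θ i)
        + α * ((θ i)⁻¹ ^ 2 + 2 * (θ i)⁻¹) * (β - θ i) ^ 2 + β)
    (hineq : 0 ≥ (∑ i ∈ Finset.univ \ {i₀}, (c i) ^ 2 * J i) + (c i₀) ^ 2 * I₁
        + ((n : ℝ) * α - 1) * K ^ α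
            * ((lam i₀)⁻¹ - (1 / (n : ℝ)) * ∑ i : Fin n, (lam i)⁻¹)) :
    (∀ i, c i = 0) ∧ ∀ i j, lam i = lam j := by
  have hn₂ : (2 : ℝ) ≤ n := by exact_mod_cast hn
  have hn₀ : (0 : ℝ) < n := by linarith
  have hα₀ : 0 < α := lt_trans (by positivity) hα₁
  have hnα : 0 < (n : ℝ) * α - 1 := by
    rw [div_lt_iff₀ hn₀] at hα₁
    linarith
  have hβ₀ : 0 < β := by
    rw [hβ]
    positivity
  have hαβ : α * β = α - 1 / n := by
    rw [hβ]
    field_simp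
  have hJ₀ : ∀ i, 0 < J i := fun i => by
    rw [hJ]
    refine pogorelov_coeff_pos hα₀ hβ₀ (by linarith) ?_
    rw [hθ]
    exact div_pos (hpos i) (hpos i₀)
  have hI₀ : 0 < I₁ := by
    have hu : 1 / (n : ℝ) ≤ 1 / 2 := one_div_le_one_div_of_le two_pos hn₂
    have hu₀ : 0 < 1 / (n : ℝ) := by positivity
    have h : 0 < α * I₁ := by
      rw [hI₁, mul_sub, mul_add, hαβ]
      nlinarith [mul_pos (sub_pos.mpr hα₁) (sub_pos.mpr hα₂)]
    exact pos_of_mul_pos_right h hα₀.le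
  have hinv : ∀ i, (lam i)⁻¹ ≤ (lam i₀)⁻¹ := fun i => inv_anti₀ (hpos i₀) (hmin i)
  have hK₀ : 0 < ((n : ℝ) * α - 1) * K ^ α := by
    have : 0 < K := hK ▸ Finset.prod_pos fun i _ => hpos i
    exact mul_pos hnα (Real.rpow_pos_of_pos this α)
  have hmean : 0 ≤ (lam i₀)⁻¹ - (1 / (n : ℝ)) * ∑ i : Fin n, (lam i)⁻¹ := by
    have h : ∑ i : Fin n, (lam i)⁻¹ ≤ n * (lam i₀)⁻¹ := by
      simpa using Finset.sum_le_sum fun i (_ : i ∈ Finset.univ) => hinv i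
    rw [one_div_mul_eq_div, sub_nonneg, div_le_iff₀ hn₀]
    linarith
  have hterm : ∀ i ∈ Finset.univ \ {i₀}, 0 ≤ c i ^ 2 * J i :=
    fun i _ => mul_nonneg (sq_nonneg _) (hJ₀ i).le
  have hsum := Finset.sum_nonneg hterm
  have hc₀ : 0 ≤ c i₀ ^ 2 * I₁ := by positivity
  have hlast := mul_nonneg hK₀.le hmean
  constructor
  · intro i
    by_cases hi : i = i₀
    · subst hi
      have h : c i ^ 2 * I₁ = 0 := by linarith
      simpa [hI₀.ne'] using h
    · have h := (Finset.sum_eq_zero_iff_of_nonneg hterm).mp (by linarith) i (by simp [hi])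
      simpa [(hJ₀ i).ne'] using h
  · have h : (lam i₀)⁻¹ - (1 / (n : ℝ)) * ∑ i : Fin n, (lam i)⁻¹ ≤ 0 := by
      by_contra! h
      linarith [mul_pos hK₀ h]
    have heq : ∀ i, lam i = lam i₀ := fun i =>
      inv_injective (eq_of_le_of_le_mean (by omega) hinv (by linarith) i)
    intro i j
    rw [heq i, heq j]
end

section
/- Let n ≥ 1, let μ₁, …, μₙ be positive real numbers satisfying μᵢ ≥ (9/10)·μⱼ for all indices i, j, and let x : {1,…,n}³ → ℝ be fully symmetric (invariant under all permutations of its three indices). Then Σ_{i,j,k} μᵢ²·μⱼ·μₖ·x_{ijk}² ≥ Σᵢ μᵢ⁴·x_{iii}² + (5/2)·Σ_{i≠j} μⱼ⁴·x_{ijj}². -/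
/-- The sum of a nonnegative function over all triples is at least its sum over the triples
with at least two equal indices. -/
theorem sum_diag_add_sum_two_equal_le {ι : Type*} [Fintype ι] [DecidableEq ι]
    (g : ι → ι → ι → ℝ) (hg : ∀ i j k, 0 ≤ g i j k) :
    (∑ i, g i i i) + ∑ i, ∑ j ∈ Finset.univ \ {i}, (g i j j + g j i j + g j j i)
      ≤ ∑ i, ∑ j, ∑ k, g i j k := by
  have offdiag (f : ι → ι → ℝ) :
      ∑ i, ∑ j ∈ Finset.univ \ {i}, f i j = ∑ i, ∑ j, if i = j then 0 else f i j := by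
    refine Finset.sum_congr rfl fun i _ => ?_
    rw [← Finset.sum_filter_add_sum_filter_not Finset.univ (fun j => i = j)
      (fun j => if i = j then 0 else f i j)]
    rw [Finset.sum_eq_zero (s := Finset.univ.filter fun j => i = j)
      (fun j hj => if_pos (Finset.mem_filter.mp hj).2), zero_add]
    refine Finset.sum_congr ?_ fun j hj => ?_
    · ext j
      simp [eq_comm]
    · rw [if_neg]
      rintro rfl
      simp at hj
  have hpt (i j k : ι) :
      (if j = k then (if i = j then g i i i else 0) + (if i = j then 0 else g i j j) else 0)
        + (if i = k then (if i = j then 0 else g i j i) else 0)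
        + (if i = j then (if i = k then 0 else g i i k) else 0) ≤ g i j k := by
    have := hg i j k
    split_ifs <;> subst_vars <;> simp_all
  refine le_trans (le_of_eq ?_) (Finset.sum_le_sum fun i _ =>
    Finset.sum_le_sum fun j _ => Finset.sum_le_sum fun k _ => hpt i j k)
  have hswap : ∑ i, ∑ j, (if i = j then 0 else g j i j)
      = ∑ i, ∑ j, if i = j then 0 else g i j i := by
    rw [Finset.sum_comm]
    simp only [eq_comm]
  have hswap' : ∑ i, ∑ j, (if i = j then 0 else g j j i)
      = ∑ i, ∑ j, if i = j then 0 else g i i j := by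
    rw [Finset.sum_comm]
    simp only [eq_comm]
  have hthird : ∑ i, ∑ j, ∑ k, (if i = j then (if i = k then 0 else g i i k) else 0)
      = ∑ i, ∑ k, if i = k then 0 else g i i k := by
    refine Finset.sum_congr rfl fun i _ => ?_
    rw [Finset.sum_comm]
    simp
  simp only [Finset.sum_add_distrib, offdiag, hswap, hswap', hthird, Finset.sum_ite_eq,
    Finset.mem_univ, if_true]
  ring

/-- With `t = a / b ≥ 9 / 10`, this is `t ^ 2 + 2 * t ≥ 5 / 2`. -/
theorem five_halves_mul_pow_four_le {a b : ℝ} (hb : 0 < b) (hab : 9 / 10 * b ≤ a) :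
    5 / 2 * b ^ 4 ≤ a ^ 2 * b ^ 2 + 2 * (b ^ 3 * a) := by
  have h : 5 / 2 * b ^ 2 ≤ a ^ 2 + 2 * (a * b) := by nlinarith
  nlinarith [mul_le_mul_of_nonneg_left h (sq_nonneg b)]

open Finset in
/-- Third-order-term estimate in Section 4: for positive reals `μᵢ` with
`μᵢ ≥ (9/10)μⱼ` for all `i, j`, and a fully symmetric array `x_{ijk}`,
`Σ_{i,j,k} μᵢ²μⱼμₖ x_{ijk}² ≥ Σᵢ μᵢ⁴x_{iii}² + (5/2)Σ_{i≠j} μⱼ⁴x_{ijj}²`. -/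
theorem third_order_estimate (n : ℕ) (hn : 1 ≤ n) (μ : Fin n → ℝ)
    (hpos : ∀ i, 0 < μ i)
    (hpinch : ∀ i j, (9 / 10 : ℝ) * μ j ≤ μ i)
    (x : Fin n → Fin n → Fin n → ℝ)
    (hsymm₁ : ∀ i j k, x i j k = x j i k)
    (hsymm₂ : ∀ i j k, x i j k = x i k j) :
    (∑ i : Fin n, (μ i) ^ 4 * (x i i i) ^ 2)
      + (5 / 2) * ∑ i : Fin n, ∑ j ∈ Finset.univ \ {i}, (μ j) ^ 4 * (x i j j) ^ 2
      ≤ ∑ i : Fin n, ∑ j : Fin n, ∑ k : Fin n,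
          (μ i) ^ 2 * μ j * μ k * (x i j k) ^ 2 := by
  refine le_trans ?_ (sum_diag_add_sum_two_equal_le
    (fun i j k => (μ i) ^ 2 * μ j * μ k * (x i j k) ^ 2) fun i j k => ?_)
  · rw [Finset.mul_sum]
    refine add_le_add (le_of_eq (Finset.sum_congr rfl fun i _ => by ring))
      (Finset.sum_le_sum fun i _ => ?_)
    rw [Finset.mul_sum]
    refine Finset.sum_le_sum fun j _ => ?_
    have h := mul_le_mul_of_nonneg_right
      (five_halves_mul_pow_four_le (hpos j) (hpinch i j)) (sq_nonneg (x i j j))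
    rw [hsymm₂ j j i, hsymm₁ j i j]
    linarith
  · have := hpos j
    have := hpos k
    positivity
end
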